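/- arXiv:2102.04393 — 2 statements merged into one kernel-verified Lean document; each statement's English description precedes it below -/
import Mathlib

section
/- The map Φ is a continuous surjection from 𝒢_n onto the set of full-order stabilizing controllers: (i) for every Z ∈ 𝒢_n the matrix Φ(Z) is well defined, Φ_D(Z) = 0, and the controller (Φ_A(Z), Φ_B(Z), Φ_C(Z)) of order n belongs to 𝒞_n; (ii) Φ is continuous on 𝒢_n; (iii) for every K = (A_K, B_K, C_K) ∈ 𝒞_n there exists Z ∈ 𝒢_n with Φ_A(Z) = A_K, Φ_B(Z) = B_K, Φ_C(Z) = C_K. -/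
open Matrix

noncomputable section

/-- A real square matrix is stable (Hurwitz): every eigenvalue of the matrix,
regarded as a complex matrix, has negative real part. -/
def IsStableMatrix {k : Type*} [Fintype k] [DecidableEq k] (M : Matrix k k ℝ) : Prop :=
  ∀ μ ∈ spectrum ℂ (M.map (algebraMap ℝ ℂ)), μ.re < 0

/-- The closed-loop matrix of the plant `(A, B, C)` with a full-order dynamic controller
`K = (A_K, B_K, C_K)`. -/
def Acl {n m p : ℕ} (A : Matrix (Fin n) (Fin n) ℝ) (B : Matrix (Fin n) (Fin m) ℝ)
    (C : Matrix (Fin p) (Fin n) ℝ)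
    (K : Matrix (Fin n) (Fin n) ℝ × Matrix (Fin n) (Fin p) ℝ × Matrix (Fin m) (Fin n) ℝ) :
    Matrix (Fin n ⊕ Fin n) (Fin n ⊕ Fin n) ℝ :=
  fromBlocks A (B * K.2.2) (K.2.1 * C) K.1

/-- The parameter space of the convex lifting:
tuples `Z = (X, Y, M, H, F, Π, Ξ)`. -/
abbrev GType (n m p : ℕ) :=
  Matrix (Fin n) (Fin n) ℝ × Matrix (Fin n) (Fin n) ℝ × Matrix (Fin n) (Fin n) ℝ ×
    Matrix (Fin n) (Fin p) ℝ × Matrix (Fin m) (Fin n) ℝ ×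
    Matrix (Fin n) (Fin n) ℝ × Matrix (Fin n) (Fin n) ℝ

/-- The matrix `N = [[A·X + B·F, A],[M, Y·A + H·C]]` appearing in the definition of `ℱ_n`. -/
def Nmat {n m p : ℕ} (A : Matrix (Fin n) (Fin n) ℝ) (B : Matrix (Fin n) (Fin m) ℝ)
    (C : Matrix (Fin p) (Fin n) ℝ) (X Y M : Matrix (Fin n) (Fin n) ℝ)
    (H : Matrix (Fin n) (Fin p) ℝ) (F : Matrix (Fin m) (Fin n) ℝ) :
    Matrix (Fin n ⊕ Fin n) (Fin n ⊕ Fin n) ℝ :=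
  fromBlocks (A * X + B * F) A M (Y * A + H * C)

/-- The set `𝒢_n`: tuples `(X, Y, M, H, F, Π, Ξ)` with `(X, Y, M, H, F) ∈ ℱ_n`
(i.e. `X`, `Y` symmetric, `[[X, I],[I, Y]] ≻ 0`, `N + Nᵀ ≺ 0`) and `Ξ·Π = I − Y·X`. -/
def Gset {n m p : ℕ} (A : Matrix (Fin n) (Fin n) ℝ) (B : Matrix (Fin n) (Fin m) ℝ)
    (C : Matrix (Fin p) (Fin n) ℝ) : Set (GType n m p) :=
  {Z | Z.1.IsSymm ∧ Z.2.1.IsSymm ∧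
    (fromBlocks Z.1 (1 : Matrix (Fin n) (Fin n) ℝ) 1 Z.2.1).PosDef ∧
    (-(Nmat A B C Z.1 Z.2.1 Z.2.2.1 Z.2.2.2.1 Z.2.2.2.2.1 +
        (Nmat A B C Z.1 Z.2.1 Z.2.2.1 Z.2.2.2.1 Z.2.2.2.2.1)ᵀ)).PosDef ∧
    Z.2.2.2.2.2.2 * Z.2.2.2.2.2.1 = 1 - Z.2.1 * Z.1}

/-- The change-of-variables map
`Φ(Z) = [[I, 0],[Y·B, Ξ]]⁻¹ · [[0, F],[H, M − Y·A·X]] · [[I, C·X],[0, Π]]⁻¹`. -/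
def Phi {n m p : ℕ} (A : Matrix (Fin n) (Fin n) ℝ) (B : Matrix (Fin n) (Fin m) ℝ)
    (C : Matrix (Fin p) (Fin n) ℝ) (Z : GType n m p) :
    Matrix (Fin m ⊕ Fin n) (Fin p ⊕ Fin n) ℝ :=
  (fromBlocks (1 : Matrix (Fin m) (Fin m) ℝ) 0 (Z.2.1 * B) Z.2.2.2.2.2.2)⁻¹ *
    fromBlocks (0 : Matrix (Fin m) (Fin p) ℝ) Z.2.2.2.2.1 Z.2.2.2.1
      (Z.2.2.1 - Z.2.1 * A * Z.1) *
    (fromBlocks (1 : Matrix (Fin p) (Fin p) ℝ) (C * Z.1) 0 Z.2.2.2.2.2.1)⁻¹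

lemma posDef_conj {k : Type*} [Fintype k] [DecidableEq k] {T A : Matrix k k ℝ}
    (hT : IsUnit T.det) (hA : A.PosDef) : (T * A * Tᵀ).PosDef := by
  have h := hA.mul_mul_conjTranspose_same (B := T)
    (Matrix.vecMul_injective_of_isUnit ((Matrix.isUnit_iff_isUnit_det _).2 hT))
  rwa [conjTranspose_eq_transpose_of_trivial] at h

lemma posDef_of_conj {k : Type*} [Fintype k] [DecidableEq k] {T A : Matrix k k ℝ}
    (hT : IsUnit T.det) (hA : (T * A * Tᵀ).PosDef) : A.PosDef := by
  have h := posDef_conj (T := T⁻¹) (by simpa using hT) hA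
  have e : T⁻¹ * (T * A * Tᵀ) * T⁻¹ᵀ = A := by
    rw [transpose_nonsing_inv, Matrix.mul_assoc T, Matrix.nonsing_inv_mul_cancel_left _ _ hT]
    exact Matrix.mul_nonsing_inv_cancel_right _ _ (by simpa using hT)
  rwa [e] at h

lemma lyap_quad {k : Type*} [Fintype k] [DecidableEq k] {A P : Matrix k k ℝ} (hP : Pᵀ = P)
    (a : k → ℝ) : a ⬝ᵥ ((A * P + P * Aᵀ) *ᵥ a) = 2 * ((a ᵥ* A) ⬝ᵥ (P *ᵥ a)) := by
  rw [add_mulVec, dotProduct_add, ← mulVec_mulVec, dotProduct_mulVec, ← mulVec_mulVec,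
    dotProduct_mulVec a P, mulVec_transpose, ← mulVec_transpose P, hP, dotProduct_comm (P *ᵥ a)]
  ring

lemma stable_of_lyap {k : Type*} [Fintype k] [DecidableEq k] {A P : Matrix k k ℝ}
    (hP : P.PosDef) (hQ : (-(A * P + P * Aᵀ)).PosDef) : IsStableMatrix A := by
  intro μ hμ
  have hPs : Pᵀ = P := by
    have := hP.isHermitian.eq
    rwa [conjTranspose_eq_transpose_of_trivial] at this
  rw [spectrum.mem_iff, Matrix.isUnit_iff_isUnit_det, isUnit_iff_ne_zero, not_not] at hμ
  obtain ⟨v, hv0, hv⟩ := Matrix.exists_vecMul_eq_zero_iff.2 hμ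
  have hv' : v ᵥ* (A.map (algebraMap ℝ ℂ)) = μ • v := by
    rw [Matrix.vecMul_sub, sub_eq_zero] at hv
    rw [← hv, Algebra.algebraMap_eq_smul_one, Matrix.vecMul_smul, Matrix.vecMul_one]
  set a : k → ℝ := fun i => (v i).re with ha
  set b : k → ℝ := fun i => (v i).im with hb
  have hA1 : a ᵥ* A = μ.re • a - μ.im • b := by
    ext j
    have := congrArg Complex.re (congrFun hv' j)
    simpa [vecMul, dotProduct, ha, hb] using this
  have hA2 : b ᵥ* A = μ.re • b + μ.im • a := by
    ext j
    have := congrArg Complex.im (congrFun hv' j)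
    simpa [vecMul, dotProduct, ha, hb] using this
  have hab : a ≠ 0 ∨ b ≠ 0 := by
    by_contra! h
    apply hv0
    ext i
    exact Complex.ext (congrFun h.1 i) (congrFun h.2 i)
  have qa := lyap_quad (A := A) hPs a
  have qb := lyap_quad (A := A) hPs b
  have sy : b ⬝ᵥ (P *ᵥ a) = a ⬝ᵥ (P *ᵥ b) := by
    rw [dotProduct_mulVec, ← mulVec_transpose, hPs, dotProduct_comm]
  rw [hA1, sub_dotProduct, smul_dotProduct, smul_dotProduct, sy] at qa
  rw [hA2, add_dotProduct, smul_dotProduct, smul_dotProduct] at qb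
  simp only [smul_eq_mul] at qa qb
  have Pn : ∀ x : k → ℝ, 0 ≤ x ⬝ᵥ (P *ᵥ x) := fun x => by
    simpa using hP.posSemidef.dotProduct_mulVec_nonneg x
  have Qn : ∀ x : k → ℝ, x ⬝ᵥ ((A * P + P * Aᵀ) *ᵥ x) ≤ 0 := fun x => by
    have := hQ.posSemidef.dotProduct_mulVec_nonneg x
    rw [neg_mulVec, dotProduct_neg] at this
    simpa using this
  have Qp : ∀ x : k → ℝ, x ≠ 0 → x ⬝ᵥ ((A * P + P * Aᵀ) *ᵥ x) < 0 := fun x hx => by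
    have := hQ.dotProduct_mulVec_pos hx
    rw [neg_mulVec, dotProduct_neg] at this
    simpa using this
  have key : μ.re * (a ⬝ᵥ (P *ᵥ a) + b ⬝ᵥ (P *ᵥ b)) < 0 := by
    rcases hab with h | h
    · nlinarith [Qp a h, Qn b]
    · nlinarith [Qn a, Qp b h]
  by_contra! hc
  nlinarith [mul_nonneg hc (add_nonneg (Pn a) (Pn b))]

attribute [local instance] Matrix.frobeniusNormedAddCommGroup Matrix.frobeniusNormedRing
  Matrix.frobeniusNormedAlgebra in
lemma exists_pow_small {k : Type*} [Fintype k] [DecidableEq k] [Nonempty k] (S : Matrix k k ℝ)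
    (hS : ∀ z ∈ spectrum ℂ (S.map (algebraMap ℝ ℂ)), ‖z‖ < 1) :
    ∃ l : ℕ, ∑ i, ∑ j, ((S ^ (l + 1)) i j) ^ 2 < 1 := by
  have : CompleteSpace (Matrix k k ℂ) := FiniteDimensional.complete ℂ _
  set S' := S.map (algebraMap ℝ ℂ) with hS'
  have h1 : spectralRadius ℂ S' < (1 : NNReal) :=
    spectrum.spectralRadius_lt_of_forall_lt S' (fun z hz => by
      have := hS z hz
      exact_mod_cast this)
  have h2 := (spectrum.pow_nnnorm_pow_one_div_tendsto_nhds_spectralRadius S').eventually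
    (gt_mem_nhds h1)
  obtain ⟨l, hl⟩ := ((Filter.tendsto_add_atTop_iff_nat 1).2 Filter.tendsto_id).eventually h2 |>.exists
  refine ⟨l, ?_⟩
  have h3 : ‖S' ^ (l + 1)‖ < 1 := by
    by_contra! hc
    have hc' : (1 : ENNReal) ≤ (‖S' ^ (l + 1)‖₊ : ENNReal) := by exact_mod_cast hc
    have := ENNReal.one_le_rpow hc' (z := 1 / ((l + 1 : ℕ) : ℝ)) (by positivity)
    exact absurd hl (by simpa using this)
  have h4 : S' ^ (l + 1) = (S ^ (l + 1)).map (algebraMap ℝ ℂ) := by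
    rw [hS']
    exact (map_pow (algebraMap ℝ ℂ).mapMatrix S (l + 1)).symm
  rw [h4, Matrix.frobenius_norm_map_eq _ _ (by simp), Matrix.frobenius_norm_def] at h3
  have h5 : 0 ≤ ∑ i, ∑ j, ‖(S ^ (l + 1)) i j‖ ^ (2 : ℝ) := by positivity
  rw [← Real.sqrt_eq_rpow, Real.sqrt_lt' one_pos] at h3
  simpa using h3

lemma one_sub_posDef {k : Type*} [Fintype k] [DecidableEq k] {Q : Matrix k k ℝ}
    (hQ : ∑ i, ∑ j, (Q i j) ^ 2 < 1) : (1 - Q * Qᵀ).PosDef := by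
  refine Matrix.PosDef.of_dotProduct_mulVec_pos ?_ ?_
  · simp [Matrix.IsHermitian, conjTranspose_eq_transpose_of_trivial]
  · intro x hx
    have e : star x ⬝ᵥ ((1 - Q * Qᵀ) *ᵥ x) = x ⬝ᵥ x - (x ᵥ* Q) ⬝ᵥ (x ᵥ* Q) := by
      rw [sub_mulVec, one_mulVec, dotProduct_sub, ← mulVec_mulVec, dotProduct_mulVec _ Q,
        mulVec_transpose]
      simp
    rw [e]
    have hxx : 0 < x ⬝ᵥ x := by
      have := Matrix.dotProduct_star_self_pos_iff.2 hx
      simpa using this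
    have h1 : (x ᵥ* Q) ⬝ᵥ (x ᵥ* Q) ≤ (x ⬝ᵥ x) * ∑ i, ∑ j, (Q i j) ^ 2 := by
      rw [Finset.sum_comm, Finset.mul_sum]
      refine Finset.sum_le_sum fun j _ => ?_
      have := Finset.sum_mul_sq_le_sq_mul_sq Finset.univ x (fun i => Q i j)
      simpa [vecMul, dotProduct, sq] using this
    nlinarith

lemma exists_stein {k : Type*} [Fintype k] [DecidableEq k] [Nonempty k] (S : Matrix k k ℝ)
    (hS : ∀ z ∈ spectrum ℂ (S.map (algebraMap ℝ ℂ)), ‖z‖ < 1) :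
    ∃ P : Matrix k k ℝ, P.PosDef ∧ (P - S * P * Sᵀ).PosDef := by
  obtain ⟨l, hl⟩ := exists_pow_small S hS
  refine ⟨∑ j ∈ Finset.range (l + 1), S ^ j * (S ^ j)ᵀ, ?_, ?_⟩
  · rw [Finset.sum_range_succ']
    simp only [pow_zero, transpose_one, mul_one]
    refine Matrix.PosDef.posSemidef_add (Matrix.posSemidef_sum _ fun j _ => ?_) Matrix.PosDef.one
    have := Matrix.posSemidef_self_mul_conjTranspose (S ^ (j + 1))
    rwa [conjTranspose_eq_transpose_of_trivial] at this
  · have e : S * (∑ j ∈ Finset.range (l + 1), S ^ j * (S ^ j)ᵀ) * Sᵀ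
        = ∑ j ∈ Finset.range (l + 1), S ^ (j + 1) * (S ^ (j + 1))ᵀ := by
      rw [Finset.mul_sum, Finset.sum_mul]
      refine Finset.sum_congr rfl fun j _ => ?_
      rw [pow_succ' S j, transpose_mul]
      simp only [Matrix.mul_assoc]
    rw [e, ← Finset.sum_sub_distrib, Finset.sum_range_sub' (fun j => S ^ j * (S ^ j)ᵀ)]
    simpa using one_sub_posDef hl

lemma exists_lyap {k : Type*} [Fintype k] [DecidableEq k] [Nonempty k] (A : Matrix k k ℝ)
    (hA : IsStableMatrix A) :
    ∃ P : Matrix k k ℝ, P.PosDef ∧ (-(A * P + P * Aᵀ)).PosDef := by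
  set f := (algebraMap ℝ ℂ).mapMatrix (m := k) with hf
  have hres : ∀ z : ℂ, 0 ≤ z.re → IsUnit (algebraMap ℂ (Matrix k k ℂ) z - f A) := by
    intro z hz
    by_contra h
    exact absurd (hA z h) (not_lt.2 hz)
  have hu : IsUnit (1 - A).det := by
    have := hres 1 (by simp)
    rw [map_one, ← map_one f, ← map_sub, Matrix.isUnit_iff_isUnit_det, hf, ← RingHom.map_det,
      isUnit_iff_ne_zero] at this
    rw [isUnit_iff_ne_zero]
    exact fun h => this (by rw [h, map_zero])
  set S := (1 - A)⁻¹ * (1 + A) with hSdef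
  have hS1 : (1 - A) * S = 1 + A := Matrix.mul_nonsing_inv_cancel_left _ _ hu
  have hS : ∀ z ∈ spectrum ℂ (S.map (algebraMap ℝ ℂ)), ‖z‖ < 1 := by
    intro z hz
    by_contra! hc
    apply hz
    change IsUnit (algebraMap ℂ (Matrix k k ℂ) z - f S)
    have e : (1 - f A) * (algebraMap ℂ (Matrix k k ℂ) z - f S)
        = algebraMap ℂ (Matrix k k ℂ) (z - 1) - (z + 1) • f A := by
      have h := congrArg f hS1
      rw [map_mul, map_sub, map_add, map_one] at h
      rw [mul_sub, h, Algebra.algebraMap_eq_smul_one, Algebra.algebraMap_eq_smul_one, sub_mul,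
        one_mul, mul_smul_comm, mul_one, sub_smul, add_smul, one_smul, one_smul]
      abel
    have hu2 : IsUnit ((1 - f A) * (algebraMap ℂ (Matrix k k ℂ) z - f S)) := by
      rw [e]
      by_cases hz1 : z + 1 = 0
      · rw [hz1, zero_smul, sub_zero]
        refine IsUnit.map _ (isUnit_iff_ne_zero.2 ?_)
        have : z = -1 := by linear_combination hz1
        rw [this]; norm_num
      · have e2 : algebraMap ℂ (Matrix k k ℂ) (z - 1) - (z + 1) • f A
            = (z + 1) • (algebraMap ℂ (Matrix k k ℂ) ((z - 1) / (z + 1)) - f A) := by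
          rw [smul_sub, Algebra.algebraMap_eq_smul_one, Algebra.algebraMap_eq_smul_one, smul_smul,
            mul_div_cancel₀ _ hz1]
        rw [e2, Algebra.smul_def]
        refine IsUnit.mul (IsUnit.map _ (isUnit_iff_ne_zero.2 hz1)) (hres _ ?_)
        have hsq : 1 ≤ z.re * z.re + z.im * z.im := by
          have h1 : 1 ≤ ‖z‖ * ‖z‖ := by nlinarith
          rwa [Complex.norm_mul_self_eq_normSq, Complex.normSq_apply] at h1
        rw [Complex.div_re, ← add_div]
        refine div_nonneg ?_ (Complex.normSq_nonneg _)
        simp only [Complex.sub_re, Complex.add_re, Complex.sub_im, Complex.add_im, Complex.one_re,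
          Complex.one_im]
        nlinarith
    exact isUnit_of_mul_isUnit_right hu2
  obtain ⟨P, hP, hQ⟩ := exists_stein S hS
  refine ⟨P, hP, ?_⟩
  have h := posDef_conj hu hQ
  have e : (1 - A) * (P - S * P * Sᵀ) * (1 - A)ᵀ = (2 : ℝ) • (-(A * P + P * Aᵀ)) := by
    have : (1 - A) * (P - S * P * Sᵀ) * (1 - A)ᵀ
        = (1 - A) * P * (1 - A)ᵀ - ((1 - A) * S) * P * ((1 - A) * S)ᵀ := by
      rw [transpose_mul (1 - A) S, mul_sub, sub_mul]
      simp only [Matrix.mul_assoc]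
    rw [this, hS1, two_smul]
    simp only [transpose_sub, transpose_add, transpose_one]
    noncomm_ring
  rw [e] at h
  have := h.smul (show (0 : ℝ) < 1 / 2 by norm_num)
  rwa [smul_smul, show (1 / 2 : ℝ) * 2 = 1 by norm_num, one_smul] at this

lemma posDef_eventually {k : Type*} [Fintype k] [DecidableEq k] {P J : Matrix k k ℝ}
    (hP : P.PosDef) (hJ : Jᵀ = J) : ∀ᶠ ε : ℝ in nhds 0, (P + ε • J).PosDef := by
  have hc : Continuous fun q : ℝ × (k → ℝ) => q.2 ⬝ᵥ ((P + q.1 • J) *ᵥ q.2) := by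
    fun_prop
  have h := (isCompact_sphere (0 : k → ℝ) 1).eventually_forall_of_forall_eventually
    (x₀ := (0 : ℝ)) (P := fun ε x => 0 < x ⬝ᵥ ((P + ε • J) *ᵥ x)) (by
      intro x hx
      have hx0 : x ≠ 0 := by
        rintro rfl
        simp at hx
      have h0 : (0 : ℝ) < x ⬝ᵥ ((P + (0 : ℝ) • J) *ᵥ x) := by
        simpa using hP.dotProduct_mulVec_pos hx0
      exact (hc.continuousAt (x := ((0 : ℝ), x))).eventually (lt_mem_nhds h0))
  filter_upwards [h] with ε hε
  refine Matrix.PosDef.of_dotProduct_mulVec_pos ?_ ?_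
  · have := hP.isHermitian.eq
    rw [conjTranspose_eq_transpose_of_trivial] at this
    rw [Matrix.IsHermitian, conjTranspose_eq_transpose_of_trivial]
    simp [this, hJ]
  · intro x hx
    have hn : 0 < ‖x‖ := norm_pos_iff.2 hx
    have := hε (‖x‖⁻¹ • x) (by simp [norm_smul, hn.ne'])
    rw [mulVec_smul, smul_dotProduct, dotProduct_smul, smul_eq_mul, smul_eq_mul] at this
    have h2 := pos_of_mul_pos_right this (by positivity)
    simpa using pos_of_mul_pos_right h2 (by positivity)

lemma exists_lyap_offdiag {n : ℕ} (hn : 0 < n) (A : Matrix (Fin n ⊕ Fin n) (Fin n ⊕ Fin n) ℝ)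
    (hA : IsStableMatrix A) :
    ∃ P : Matrix (Fin n ⊕ Fin n) (Fin n ⊕ Fin n) ℝ, P.PosDef ∧
      (-(A * P + P * Aᵀ)).PosDef ∧ IsUnit P.toBlocks₂₁.det := by
  have : Nonempty (Fin n) := ⟨⟨0, hn⟩⟩
  obtain ⟨P, hP, hQ⟩ := exists_lyap A hA
  set J : Matrix (Fin n ⊕ Fin n) (Fin n ⊕ Fin n) ℝ := fromBlocks 0 1 1 0 with hJ
  have hJs : Jᵀ = J := by simp [hJ, fromBlocks_transpose]
  have e1 := posDef_eventually hP hJs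
  have e2 := posDef_eventually hQ (J := -(A * J + J * Aᵀ)) (by
    simp [transpose_mul, hJs, add_comm])
  have e3 : ∀ᶠ ε : ℝ in nhdsWithin 0 {0}ᶜ, ε ∉ spectrum ℝ (-P.toBlocks₂₁) := by
    have hf : (spectrum ℝ (-P.toBlocks₂₁) \ {0}).Finite :=
      (Matrix.finite_spectrum _).subset Set.sdiff_subset
    have := hf.isClosed.isOpen_compl.mem_nhds (x := (0 : ℝ)) (by simp)
    filter_upwards [nhdsWithin_le_nhds this, self_mem_nhdsWithin] with ε h1 h2 h3
    exact h1 ⟨h3, h2⟩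
  obtain ⟨ε, h1, h2, h3⟩ :=
    ((e1.filter_mono nhdsWithin_le_nhds).and ((e2.filter_mono nhdsWithin_le_nhds).and e3)).exists
  refine ⟨P + ε • J, h1, ?_, ?_⟩
  · convert h2 using 1
    rw [mul_add, add_mul, mul_smul_comm, smul_mul_assoc, smul_neg, smul_add]
    abel
  · rw [spectrum.notMem_iff, Matrix.isUnit_iff_isUnit_det] at h3
    have e : (P + ε • J).toBlocks₂₁
        = algebraMap ℝ (Matrix (Fin n) (Fin n) ℝ) ε - -P.toBlocks₂₁ := by
      ext i j
      simp [toBlocks₂₁, hJ, Algebra.algebraMap_eq_smul_one, add_comm]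
    rwa [e]

lemma TU_eq {n : ℕ} {X Y Pi Xi : Matrix (Fin n) (Fin n) ℝ} (h : Xi * Pi = 1 - Y * X) :
    (fromBlocks 1 0 Y Xi : Matrix (Fin n ⊕ Fin n) (Fin n ⊕ Fin n) ℝ) * fromBlocks X 1 Pi 0
      = fromBlocks X 1 1 Y := by
  rw [fromBlocks_multiply, h]
  simp

lemma isUnit_PiXi {n : ℕ} {X Y Pi Xi : Matrix (Fin n) (Fin n) ℝ} (h : Xi * Pi = 1 - Y * X)
    (hG : (fromBlocks X (1 : Matrix (Fin n) (Fin n) ℝ) 1 Y).PosDef) :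
    IsUnit Xi.det ∧ IsUnit Pi.det := by
  have hd : IsUnit (fromBlocks X (1 : Matrix (Fin n) (Fin n) ℝ) 1 Y).det :=
    (Matrix.isUnit_iff_isUnit_det _).1 hG.isUnit
  rw [← TU_eq h, det_mul, det_fromBlocks_zero₁₂, det_one, one_mul] at hd
  refine ⟨isUnit_of_mul_isUnit_left hd, ?_⟩
  have e : (fromBlocks X 1 Pi 0 : Matrix (Fin n ⊕ Fin n) (Fin n ⊕ Fin n) ℝ)
      = fromBlocks 1 0 0 Pi * fromBlocks X 1 1 0 := by
    rw [fromBlocks_multiply]; simp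
  have h2 := isUnit_of_mul_isUnit_right hd
  rw [e, det_mul, det_fromBlocks_zero₁₂, det_one, one_mul] at h2
  exact isUnit_of_mul_isUnit_left h2

/-- The key identity `T · A_cl · U = N`. -/
lemma T_Acl_U {n m p : ℕ} (A : Matrix (Fin n) (Fin n) ℝ) (B : Matrix (Fin n) (Fin m) ℝ)
    (C : Matrix (Fin p) (Fin n) ℝ) (X Y M Pi Xi AK : Matrix (Fin n) (Fin n) ℝ)
    (BK : Matrix (Fin n) (Fin p) ℝ) (CK : Matrix (Fin m) (Fin n) ℝ)
    (hM : Y * B * CK * Pi + Xi * BK * C * X + Xi * AK * Pi = M - Y * A * X) :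
    fromBlocks 1 0 Y Xi * Acl A B C (AK, BK, CK) * fromBlocks X 1 Pi 0
      = Nmat A B C X Y M (Xi * BK) (CK * Pi) := by
  have hM' : M = Y * A * X + (Y * B * CK * Pi + Xi * BK * C * X + Xi * AK * Pi) := by
    rw [hM]; abel
  rw [hM', Acl, Nmat, fromBlocks_multiply, fromBlocks_multiply]
  congr 1
  · simp [Matrix.mul_assoc]
  · simp
  · simp only [Matrix.add_mul, Matrix.mul_assoc]; abel
  · simp [Matrix.mul_assoc]

/-- The Lyapunov inequality transported by the congruence `T`. -/
lemma lyap_congr {n : ℕ} {T U Ac P : Matrix (Fin n ⊕ Fin n) (Fin n ⊕ Fin n) ℝ}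
    (hP : Pᵀ = P) (hU : P * Tᵀ = U) :
    T * (-(Ac * P + P * Acᵀ)) * Tᵀ = -(T * Ac * U + (T * Ac * U)ᵀ) := by
  subst hU
  simp only [transpose_mul, transpose_transpose, hP, Matrix.mul_neg, Matrix.neg_mul,
    Matrix.mul_add, Matrix.add_mul, Matrix.mul_assoc]

lemma Phi_eq_iff {n m p : ℕ} (A : Matrix (Fin n) (Fin n) ℝ) (B : Matrix (Fin n) (Fin m) ℝ)
    (C : Matrix (Fin p) (Fin n) ℝ) (X Y M Pi Xi AK : Matrix (Fin n) (Fin n) ℝ)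
    (H : Matrix (Fin n) (Fin p) ℝ) (F : Matrix (Fin m) (Fin n) ℝ)
    (BK : Matrix (Fin n) (Fin p) ℝ) (CK : Matrix (Fin m) (Fin n) ℝ) (D : Matrix (Fin m) (Fin p) ℝ)
    (hXi : IsUnit Xi.det) (hPi : IsUnit Pi.det) :
    Phi A B C (X, Y, M, H, F, Pi, Xi) = fromBlocks D CK BK AK ↔
      D = 0 ∧ CK * Pi = F ∧ Xi * BK = H ∧
      Y * B * CK * Pi + Xi * BK * C * X + Xi * AK * Pi = M - Y * A * X := by
  set L := fromBlocks (1 : Matrix (Fin m) (Fin m) ℝ) 0 (Y * B) Xi with hL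
  set R := fromBlocks (1 : Matrix (Fin p) (Fin p) ℝ) (C * X) 0 Pi with hR
  have hLu : IsUnit L.det := by rw [hL, det_fromBlocks_zero₁₂]; simpa using hXi
  have hRu : IsUnit R.det := by rw [hR, det_fromBlocks_zero₂₁]; simpa using hPi
  have key : Phi A B C (X, Y, M, H, F, Pi, Xi) = fromBlocks D CK BK AK ↔
      L * fromBlocks D CK BK AK * R = fromBlocks 0 F H (M - Y * A * X) := by
    change L⁻¹ * fromBlocks 0 F H (M - Y * A * X) * R⁻¹ = _ ↔ _
    constructor
    · intro h
      rw [← h, Matrix.mul_assoc L⁻¹, Matrix.mul_nonsing_inv_cancel_left _ _ hLu,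
        Matrix.nonsing_inv_mul_cancel_right _ _ hRu]
    · intro h
      rw [← h, Matrix.mul_assoc L, Matrix.nonsing_inv_mul_cancel_left _ _ hLu,
        Matrix.mul_nonsing_inv_cancel_right _ _ hRu]
  rw [key, hL, hR, fromBlocks_multiply, fromBlocks_multiply, fromBlocks_inj]
  constructor
  · rintro ⟨h1, h2, h3, h4⟩
    have hD : D = 0 := by simpa using h1
    subst hD
    refine ⟨rfl, by simpa using h2, by simpa using h3, ?_⟩
    rw [← h4]
    simp only [Matrix.mul_zero, Matrix.add_mul, Matrix.mul_assoc, zero_add]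
    abel
  · rintro ⟨rfl, h2, h3, h4⟩
    refine ⟨by simp, by simpa using h2, by simpa using h3, ?_⟩
    rw [← h4]
    simp only [Matrix.mul_zero, Matrix.add_mul, Matrix.mul_assoc, zero_add]
    abel

lemma continuous_matrix_inv {α k : Type*} [TopologicalSpace α] [Fintype k] [DecidableEq k]
    {f : α → Matrix k k ℝ} (hf : Continuous f) (hs : ∀ x, IsUnit (f x).det) :
    Continuous (fun x => (f x)⁻¹) := by
  simp only [Matrix.inv_def, Ring.inverse_eq_inv']
  exact (hf.matrix_det.inv₀ fun x => (hs x).ne_zero).smul hf.matrix_adjugate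

/-- `Φ` is a continuous surjection from `𝒢_n` onto the set `𝒞_n` of
full-order stabilizing controllers: (i) for every `Z ∈ 𝒢_n` we have `Φ_D(Z) = 0` and the
controller `(Φ_A(Z), Φ_B(Z), Φ_C(Z))` stabilizes the plant; (ii) `Φ` is continuous on
`𝒢_n`; (iii) every `K ∈ 𝒞_n` arises as the block decomposition of `Φ(Z)` for some
`Z ∈ 𝒢_n`. -/
theorem Phi_continuous_surjective (n m p : ℕ) (hn : 0 < n) (hm : 0 < m) (hp : 0 < p)
    (A : Matrix (Fin n) (Fin n) ℝ) (B : Matrix (Fin n) (Fin m) ℝ)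
    (C : Matrix (Fin p) (Fin n) ℝ) :
    (∀ Z ∈ Gset A B C, (Phi A B C Z).toBlocks₁₁ = 0 ∧
      IsStableMatrix (Acl A B C
        ((Phi A B C Z).toBlocks₂₂, (Phi A B C Z).toBlocks₂₁, (Phi A B C Z).toBlocks₁₂))) ∧
    ContinuousOn (Phi A B C) (Gset A B C) ∧
    (∀ K : Matrix (Fin n) (Fin n) ℝ × Matrix (Fin n) (Fin p) ℝ × Matrix (Fin m) (Fin n) ℝ,
      IsStableMatrix (Acl A B C K) →
        ∃ Z ∈ Gset A B C, (Phi A B C Z).toBlocks₂₂ = K.1 ∧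
          (Phi A B C Z).toBlocks₂₁ = K.2.1 ∧ (Phi A B C Z).toBlocks₁₂ = K.2.2) := by
  refine ⟨?_, ?_, ?_⟩
  · rintro ⟨X, Y, M, H, F, Pi, Xi⟩ ⟨hX, hY, hG, hN, hXP⟩
    dsimp only at hX hY hG hN hXP
    obtain ⟨hXi, hPi⟩ := isUnit_PiXi hXP hG
    obtain ⟨hD, hF, hH, hM⟩ := (Phi_eq_iff A B C X Y M Pi Xi _ H F _ _ _ hXi hPi).1
      (fromBlocks_toBlocks (Phi A B C (X, Y, M, H, F, Pi, Xi))).symm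
    refine ⟨hD, ?_⟩
    have hTAU := T_Acl_U A B C X Y M Pi Xi _ _ _ hM
    rw [hF, hH] at hTAU
    have hTU := TU_eq hXP
    set T : Matrix (Fin n ⊕ Fin n) (Fin n ⊕ Fin n) ℝ := fromBlocks 1 0 Y Xi with hT
    set U : Matrix (Fin n ⊕ Fin n) (Fin n ⊕ Fin n) ℝ := fromBlocks X 1 Pi 0 with hU
    have hTu : IsUnit T.det := by rw [hT, det_fromBlocks_zero₁₂]; simpa using hXi
    have hTu' : IsUnit Tᵀ.det := by simpa using hTu
    have hPT : (U * Tᵀ⁻¹) * Tᵀ = U := Matrix.nonsing_inv_mul_cancel_right _ _ hTu'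
    have hP : (U * Tᵀ⁻¹).PosDef := by
      refine posDef_of_conj hTu ?_
      rw [Matrix.mul_assoc, hPT, hTU]
      exact hG
    have hPs : (U * Tᵀ⁻¹)ᵀ = U * Tᵀ⁻¹ := by
      have := hP.isHermitian.eq
      rwa [conjTranspose_eq_transpose_of_trivial] at this
    refine stable_of_lyap hP (posDef_of_conj hTu ?_)
    rw [lyap_congr hPs hPT, hTAU]
    exact hN
  · unfold Phi
    rw [continuousOn_iff_continuous_domRestrict]
    have hu : ∀ Z : Gset A B C, IsUnit Z.1.2.2.2.2.2.2.det ∧ IsUnit Z.1.2.2.2.2.2.1.det :=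
      fun Z => isUnit_PiXi Z.2.2.2.2.2 Z.2.2.2.1
    refine Continuous.matrix_mul (Continuous.matrix_mul ?_ ?_) ?_
    · refine continuous_matrix_inv ?_ fun Z => ?_
      · fun_prop
      · rw [det_fromBlocks_zero₁₂]
        simpa using (hu Z).1
    · refine Continuous.matrix_fromBlocks ?_ ?_ ?_ ?_ <;> fun_prop
    · refine continuous_matrix_inv ?_ fun Z => ?_
      · fun_prop
      · rw [det_fromBlocks_zero₂₁]
        simpa using (hu Z).2
  · rintro ⟨AK, BK, CK⟩ hK
    obtain ⟨P, hP, hQ, hPi⟩ := exists_lyap_offdiag hn _ hK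
    have hPs : Pᵀ = P := by
      have := hP.isHermitian.eq
      rwa [conjTranspose_eq_transpose_of_trivial] at this
    have hPu : IsUnit P.det := (Matrix.isUnit_iff_isUnit_det _).1 hP.isUnit
    have hIs : P⁻¹ᵀ = P⁻¹ := by rw [transpose_nonsing_inv, hPs]
    set X := P.toBlocks₁₁ with hX
    set Pi := P.toBlocks₂₁ with hPidef
    set Y := P⁻¹.toBlocks₁₁ with hY
    set Xi := P⁻¹.toBlocks₁₂ with hXidef
    have hXs : Xᵀ = X := by
      ext i j; exact congrFun (congrFun hPs (Sum.inl i)) (Sum.inl j)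
    have hYs : Yᵀ = Y := by
      ext i j; exact congrFun (congrFun hIs (Sum.inl i)) (Sum.inl j)
    have hPiT : P.toBlocks₁₂ = Piᵀ := by
      ext i j; exact (congrFun (congrFun hPs (Sum.inl i)) (Sum.inr j)).symm
    have hPb : P = fromBlocks X Piᵀ Pi P.toBlocks₂₂ := by
      rw [← hPiT]; exact (fromBlocks_toBlocks P).symm
    have hIb : P⁻¹ = fromBlocks Y Xi P⁻¹.toBlocks₂₁ P⁻¹.toBlocks₂₂ :=
      (fromBlocks_toBlocks P⁻¹).symm
    have hone : P⁻¹ * P = 1 := Matrix.nonsing_inv_mul _ hPu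
    rw [hIb] at hone
    nth_rewrite 3 [hPb] at hone
    rw [fromBlocks_multiply, ← fromBlocks_one, fromBlocks_inj] at hone
    obtain ⟨h11, h12, -, -⟩ := hone
    have hXP : Xi * Pi = 1 - Y * X := by rw [← h11]; abel
    set T : Matrix (Fin n ⊕ Fin n) (Fin n ⊕ Fin n) ℝ := fromBlocks 1 0 Y Xi with hT
    set U : Matrix (Fin n ⊕ Fin n) (Fin n ⊕ Fin n) ℝ := fromBlocks X 1 Pi 0 with hU
    have hTP : T * P = Uᵀ := by
      rw [hPb, hT, hU, fromBlocks_multiply, fromBlocks_transpose, h11, h12, hXs]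
      simp
    have hPT : P * Tᵀ = U := by
      rw [← hPs, ← transpose_mul, hTP, transpose_transpose]
    have hUu : IsUnit U.det := by
      have e : U * fromBlocks 0 1 1 (-X) = fromBlocks 1 0 0 Pi := by
        rw [hU, fromBlocks_multiply]; simp
      have h2 : IsUnit (U * fromBlocks 0 1 1 (-X)).det := by
        rw [e, det_fromBlocks_zero₁₂]; simpa using hPi
      rw [det_mul] at h2
      exact isUnit_of_mul_isUnit_left h2
    have hTu : IsUnit T.det := by
      rw [← hPT, det_mul, det_transpose] at hUu
      exact isUnit_of_mul_isUnit_right hUu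
    have hXi : IsUnit Xi.det := by
      rw [hT, det_fromBlocks_zero₁₂] at hTu
      simpa using hTu
    set M := Y * A * X + (Y * B * CK * Pi + Xi * BK * C * X + Xi * AK * Pi) with hMdef
    have hM : Y * B * CK * Pi + Xi * BK * C * X + Xi * AK * Pi = M - Y * A * X := by
      rw [hMdef]; abel
    have hTAU := T_Acl_U A B C X Y M Pi Xi AK BK CK hM
    have hG : (fromBlocks X (1 : Matrix (Fin n) (Fin n) ℝ) 1 Y).PosDef := by
      have := posDef_conj hTu hP
      rwa [Matrix.mul_assoc, hPT, TU_eq hXP] at this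
    have hN := posDef_conj hTu hQ
    rw [lyap_congr hPs hPT, hTAU] at hN
    have hPhi := (Phi_eq_iff A B C X Y M Pi Xi AK (Xi * BK) (CK * Pi) BK CK 0 hXi hPi).2
      ⟨rfl, rfl, rfl, hM⟩
    refine ⟨(X, Y, M, Xi * BK, CK * Pi, Pi, Xi), ⟨hXs, hYs, hG, hN, hXP⟩, ?_, ?_, ?_⟩
    · rw [hPhi, toBlocks_fromBlocks₂₂]
    · rw [hPhi, toBlocks_fromBlocks₂₁]
    · rw [hPhi, toBlocks_fromBlocks₁₂]
end
end

section
/- Assume n ≥ 1, (A, B) is controllable, (C, A) is observable, and the plant is open-loop stable, i.e. A is a stable matrix. Then the set 𝒞_n of full-order stabilizing controllers is path-connected. -/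
open Matrix

noncomputable section

/-- `(A, B)` is controllable: the controllability matrix `[B, A·B, …, A^{r−1}·B]` has
rank `r`. -/
def Controllable {r s : ℕ} (A : Matrix (Fin r) (Fin r) ℝ) (B : Matrix (Fin r) (Fin s) ℝ) :
    Prop :=
  (Matrix.of fun (i : Fin r) (kj : Fin r × Fin s) => (A ^ (kj.1 : ℕ) * B) i kj.2).rank = r

/-- Symmetric positive definite real matrix. -/
def PDm {k : Type*} [Fintype k] (M : Matrix k k ℝ) : Prop :=
  Mᵀ = M ∧ ∀ x : k → ℝ, x ≠ 0 → 0 < x ⬝ᵥ M *ᵥ x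

/-- The quadratic form of the (not necessarily symmetric) matrix is negative definite. -/
def NDm {k : Type*} [Fintype k] (M : Matrix k k ℝ) : Prop :=
  ∀ x : k → ℝ, x ≠ 0 → x ⬝ᵥ M *ᵥ x < 0

section aux

variable {k l : Type*} [Fintype k] [DecidableEq k] [Fintype l] [DecidableEq l]

lemma mem_spectrum_iff_vec (M : Matrix k k ℂ) (μ : ℂ) :
    μ ∈ spectrum ℂ M ↔ ∃ v : k → ℂ, v ≠ 0 ∧ M *ᵥ v = μ • v := by
  rw [spectrum.mem_iff, Matrix.isUnit_iff_isUnit_det, isUnit_iff_ne_zero, not_not,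
    ← Matrix.exists_mulVec_eq_zero_iff]
  refine exists_congr fun v => and_congr_right fun _ => ?_
  rw [Matrix.sub_mulVec, sub_eq_zero, Algebra.algebraMap_eq_smul_one, Matrix.smul_mulVec,
    Matrix.one_mulVec, eq_comm]

lemma stable_iff_vec (M : Matrix k k ℝ) :
    IsStableMatrix M ↔ ∀ μ : ℂ, ∀ v : k → ℂ, v ≠ 0 →
      (M.map (algebraMap ℝ ℂ)) *ᵥ v = μ • v → μ.re < 0 := by
  unfold IsStableMatrix
  constructor
  · intro h μ v hv hM
    exact h μ ((mem_spectrum_iff_vec _ _).2 ⟨v, hv, hM⟩)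
  · intro h μ hμ
    obtain ⟨v, hv, hM⟩ := (mem_spectrum_iff_vec _ _).1 hμ
    exact h μ v hv hM

lemma map_mulVec_re (M : Matrix l k ℝ) (v : k → ℂ) :
    (fun i => ((M.map (algebraMap ℝ ℂ) *ᵥ v) i).re) = M *ᵥ (fun j => (v j).re) := by
  ext i; simp [Matrix.mulVec, dotProduct]

lemma map_mulVec_im (M : Matrix l k ℝ) (v : k → ℂ) :
    (fun i => ((M.map (algebraMap ℝ ℂ) *ᵥ v) i).im) = M *ᵥ (fun j => (v j).im) := by
  ext i; simp [Matrix.mulVec, dotProduct]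

lemma stable_iff_real (M : Matrix k k ℝ) :
    IsStableMatrix M ↔ ∀ α β : ℝ, ∀ a b : k → ℝ, (a ≠ 0 ∨ b ≠ 0) →
      M *ᵥ a = α • a - β • b → M *ᵥ b = β • a + α • b → α < 0 := by
  rw [stable_iff_vec]
  constructor
  · intro h α β a b hab ha hb
    refine h ⟨α, β⟩ (fun i => ⟨a i, b i⟩) ?_ ?_
    · intro h0
      rcases hab with h1 | h1 <;> apply h1 <;> ext i
      · simpa using congrArg Complex.re (congrFun h0 i)
      · simpa using congrArg Complex.im (congrFun h0 i)
    · ext i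
      apply Complex.ext
      · have := congrFun (map_mulVec_re M (fun i => (⟨a i, b i⟩ : ℂ))) i
        simp only at this
        rw [this, ha]; simp
      · have := congrFun (map_mulVec_im M (fun i => (⟨a i, b i⟩ : ℂ))) i
        simp only at this
        rw [this, hb]; simp; ring
  · intro h μ v hv hM
    refine h μ.re μ.im (fun j => (v j).re) (fun j => (v j).im) ?_ ?_ ?_
    · by_contra hc
      push Not at hc
      apply hv
      ext i
      apply Complex.ext
      · simpa using congrFun hc.1 i
      · simpa using congrFun hc.2 i
    · rw [← map_mulVec_re, hM]; ext i; simp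
    · rw [← map_mulVec_im, hM]; ext i; simp; ring

lemma dot_symm {E : Matrix k k ℝ} (h : Eᵀ = E) (a b : k → ℝ) :
    a ⬝ᵥ E *ᵥ b = b ⬝ᵥ E *ᵥ a := by
  conv_lhs => rw [← h]
  rw [Matrix.mulVec_transpose, dotProduct_comm, ← Matrix.dotProduct_mulVec]

/-- Pencil criterion for stability. -/
lemma stable_of_pencil (M Pi G E Z : Matrix k k ℝ) (hE : PDm E) (hZ : NDm Z)
    (hPi : IsUnit Pi) (h1 : G * Pi = E) (h2 : G * M * Pi = Z) : IsStableMatrix M := by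
  rw [stable_iff_real]
  intro α β a b hab ha hb
  rw [Matrix.isUnit_iff_isUnit_det] at hPi
  obtain ⟨u, hu⟩ : ∃ u, Pi *ᵥ u = a :=
    ⟨Pi⁻¹ *ᵥ a, by rw [Matrix.mulVec_mulVec, Matrix.mul_nonsing_inv _ hPi, Matrix.one_mulVec]⟩
  obtain ⟨w, hw⟩ : ∃ u, Pi *ᵥ u = b :=
    ⟨Pi⁻¹ *ᵥ b, by rw [Matrix.mulVec_mulVec, Matrix.mul_nonsing_inv _ hPi, Matrix.one_mulVec]⟩
  have hZu : Z *ᵥ u = α • (E *ᵥ u) - β • (E *ᵥ w) := by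
    rw [← h2, ← h1, ← Matrix.mulVec_mulVec, ← Matrix.mulVec_mulVec, ← Matrix.mulVec_mulVec,
      ← Matrix.mulVec_mulVec, hu, hw, ha, Matrix.mulVec_sub, Matrix.mulVec_smul, Matrix.mulVec_smul]
  have hZw : Z *ᵥ w = β • (E *ᵥ u) + α • (E *ᵥ w) := by
    rw [← h2, ← h1, ← Matrix.mulVec_mulVec, ← Matrix.mulVec_mulVec, ← Matrix.mulVec_mulVec,
      ← Matrix.mulVec_mulVec, hu, hw, hb, Matrix.mulVec_add, Matrix.mulVec_smul, Matrix.mulVec_smul]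
  have e1 : u ⬝ᵥ Z *ᵥ u + w ⬝ᵥ Z *ᵥ w = α * (u ⬝ᵥ E *ᵥ u + w ⬝ᵥ E *ᵥ w) := by
    rw [hZu, hZw, dotProduct_sub, dotProduct_add]
    simp only [dotProduct_smul, smul_eq_mul]
    rw [dot_symm hE.1 u w]; ring
  have Enn : ∀ x, 0 ≤ x ⬝ᵥ E *ᵥ x := fun x => by
    by_cases hx : x = 0
    · simp [hx]
    · exact (hE.2 x hx).le
  have Znn : ∀ x, x ⬝ᵥ Z *ᵥ x ≤ 0 := fun x => by
    by_cases hx : x = 0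
    · simp [hx]
    · exact (hZ x hx).le
  have key : (u ≠ 0 ∨ w ≠ 0) := by
    rcases hab with h | h
    · left; rintro rfl; exact h (by rw [← hu]; simp)
    · right; rintro rfl; exact h (by rw [← hw]; simp)
  have : 0 < u ⬝ᵥ E *ᵥ u + w ⬝ᵥ E *ᵥ w ∧ u ⬝ᵥ Z *ᵥ u + w ⬝ᵥ Z *ᵥ w < 0 := by
    rcases key with h | h
    · exact ⟨by linarith [hE.2 u h, Enn w], by linarith [hZ u h, Znn w]⟩
    · exact ⟨by linarith [hE.2 w h, Enn u], by linarith [hZ w h, Znn u]⟩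
  by_contra hα
  push Not at hα
  nlinarith [mul_nonneg hα this.1.le]

open scoped Matrix.Norms.L2Operator in
lemma exists_pow_contr [Nonempty k] (G : Matrix k k ℝ)
    (hG : ∀ z ∈ spectrum ℂ (G.map (algebraMap ℝ ℂ)), ‖z‖ < 1) :
    ∃ N : ℕ, ∀ x : k → ℝ, x ≠ 0 → ((G ^ N) *ᵥ x) ⬝ᵥ ((G ^ N) *ᵥ x) < x ⬝ᵥ x := by
  set Gc := G.map (algebraMap ℝ ℂ) with hGc
  have h1 : spectralRadius ℂ Gc < ((1 : NNReal) : ENNReal) :=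
    spectrum.spectralRadius_lt_of_forall_lt Gc (fun z hz => by
      have := hG z hz
      rw [← NNReal.coe_lt_coe]; simpa using this)
  have h2 := spectrum.pow_nnnorm_pow_one_div_tendsto_nhds_spectralRadius Gc
  obtain ⟨N, hN, hN0⟩ := ((h2.eventually (gt_mem_nhds h1)).and
    (Filter.eventually_gt_atTop 0)).exists
  have h3 : ‖Gc ^ N‖ < 1 := by
    by_contra hc
    push Not at hc
    have : (1 : ENNReal) ≤ (‖Gc ^ N‖₊ : ENNReal) := by
      exact_mod_cast (by exact_mod_cast hc : (1 : NNReal) ≤ ‖Gc ^ N‖₊)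
    have := ENNReal.one_le_rpow this (by positivity : (0 : ℝ) < 1 / N)
    exact absurd hN (by simpa using this)
  refine ⟨N, fun x hx => ?_⟩
  have h4 := Matrix.l2_opNorm_mulVec (Gc ^ N) (WithLp.toLp 2 (fun i => (x i : ℂ)))
  have hpow : Gc ^ N = (G ^ N).map (algebraMap ℝ ℂ) := by
    rw [hGc]; exact (map_pow (RingHom.mapMatrix (algebraMap ℝ ℂ)) G N).symm
  have hv : Gc ^ N *ᵥ (fun i => (x i : ℂ)) = fun i => (((G ^ N) *ᵥ x) i : ℂ) := by
    rw [hpow]; ext i; simp [Matrix.mulVec, dotProduct]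
  have hnorm : ∀ y : k → ℝ, ‖(WithLp.toLp 2 (fun i => (y i : ℂ)) : EuclideanSpace ℂ k)‖ ^ 2 = y ⬝ᵥ y := by
    intro y
    rw [EuclideanSpace.norm_sq_eq]
    simp [dotProduct, sq]
  have h5 : ‖(WithLp.toLp 2 (fun i => (((G ^ N) *ᵥ x) i : ℂ)) : EuclideanSpace ℂ k)‖ ≤
      ‖Gc ^ N‖ * ‖(WithLp.toLp 2 (fun i => (x i : ℂ)) : EuclideanSpace ℂ k)‖ := by
    rw [← hv]; exact h4
  rw [← hnorm, ← hnorm]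
  have h6 : 0 < ‖(WithLp.toLp 2 (fun i => (x i : ℂ)) : EuclideanSpace ℂ k)‖ := by
    rw [norm_pos_iff]
    intro h0
    apply hx
    ext i
    have := congrFun (congrArg WithLp.ofLp h0) i
    simpa using this
  have h7 := norm_nonneg (WithLp.toLp 2 (fun i => (((G ^ N) *ᵥ x) i : ℂ)) : EuclideanSpace ℂ k)
  exact pow_lt_pow_left₀ (lt_of_le_of_lt h5 (by nlinarith)) h7 two_ne_zero

end aux
section aux2

variable {k l : Type*} [Fintype k] [DecidableEq k] [Fintype l] [DecidableEq l]

lemma det_ne_zero_of_inj (M : Matrix k k ℝ) (h : ∀ x, M *ᵥ x = 0 → x = 0) : IsUnit M.det := by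
  rw [isUnit_iff_ne_zero]
  intro h0
  obtain ⟨v, hv, hv0⟩ := Matrix.exists_mulVec_eq_zero_iff.2 h0
  exact hv (h v hv0)

lemma cayley_spectrum (A G : Matrix k k ℝ) (hA : IsStableMatrix A) (hu : IsUnit (1 - A).det)
    (hG : G * (1 - A) = 1 + A) :
    ∀ z ∈ spectrum ℂ (G.map (algebraMap ℝ ℂ)), ‖z‖ < 1 := by
  intro μ hμ
  obtain ⟨v, hv, hGv⟩ := (mem_spectrum_iff_vec _ _).1 hμ
  rw [stable_iff_vec] at hA
  let f := RingHom.mapMatrix (m := k) (algebraMap ℝ ℂ)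
  have e1 : f G * (1 - f A) = 1 + f A := by
    rw [← map_one f, ← map_sub, ← map_mul, hG, map_add]
  have e2 : (1 - f A) * f (1 - A)⁻¹ = 1 := by
    rw [← map_one f, ← map_sub, ← map_mul, Matrix.mul_nonsing_inv _ hu]
  change f G *ᵥ v = μ • v at hGv
  obtain ⟨w, hw⟩ : ∃ w, (1 - f A) *ᵥ w = v :=
    ⟨f (1 - A)⁻¹ *ᵥ v, by rw [Matrix.mulVec_mulVec, e2, Matrix.one_mulVec]⟩
  have hw0 : w ≠ 0 := by rintro rfl; exact hv (by rw [← hw]; simp)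
  have e3 : (1 + f A) *ᵥ w = μ • (1 - f A) *ᵥ w := by
    rw [← e1, ← Matrix.mulVec_mulVec, hw, hGv]
  rw [Matrix.add_mulVec, Matrix.sub_mulVec, Matrix.one_mulVec] at e3
  have e4 : ∀ i, (μ + 1) * (f A *ᵥ w) i = (μ - 1) * w i := by
    intro i
    have := congrFun e3 i
    simp only [Pi.add_apply, Pi.smul_apply, Pi.sub_apply, smul_eq_mul] at this
    linear_combination this
  have hμ1 : μ + 1 ≠ 0 := by
    intro h0
    apply hw0
    ext i
    have := e4 i
    rw [h0, zero_mul, show μ - 1 = -2 by linear_combination h0] at this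
    simpa using this.symm
  have h5 := hA ((μ - 1) / (μ + 1)) w hw0 (by
    change f A *ᵥ w = _
    ext i
    simp only [Pi.smul_apply, smul_eq_mul]
    rw [div_mul_eq_mul_div, eq_div_iff hμ1, ← e4 i, mul_comm])
  have h6 : 0 < Complex.normSq (μ + 1) := Complex.normSq_pos.2 hμ1
  rw [Complex.div_re, ← add_div, div_lt_iff₀ h6, zero_mul] at h5
  have h7 : Complex.normSq μ < 1 := by
    rw [Complex.normSq_apply]
    simp at h5
    nlinarith
  rw [Complex.normSq_eq_norm_sq] at h7
  nlinarith [norm_nonneg μ]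

lemma lyapunov_exists [Nonempty k] (A : Matrix k k ℝ) (hA : IsStableMatrix A) :
    ∃ V : Matrix k k ℝ, PDm V ∧ NDm (V * A) := by
  have hu : IsUnit (1 - A).det := by
    apply det_ne_zero_of_inj
    intro x hx
    by_contra hx0
    rw [Matrix.sub_mulVec, Matrix.one_mulVec, sub_eq_zero] at hx
    have := (stable_iff_real A).1 hA 1 0 x 0 (Or.inl hx0) (by simp [← hx]) (by simp)
    linarith
  set G := (1 + A) * (1 - A)⁻¹ with hGdef
  have hG : G * (1 - A) = 1 + A := by
    rw [hGdef, Matrix.mul_assoc, Matrix.nonsing_inv_mul _ hu, Matrix.mul_one]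
  obtain ⟨N, hN⟩ := exists_pow_contr G (cayley_spectrum A G hA hu hG)
  have hN0 : 0 < N := by
    rcases Nat.eq_zero_or_pos N with h | h
    · subst h
      have := hN 1 (by simp)
      simp at this
    · exact h
  set V : Matrix k k ℝ := ∑ i ∈ Finset.range N, (G ^ i)ᵀ * G ^ i with hV
  have hq : ∀ x, x ⬝ᵥ V *ᵥ x = ∑ i ∈ Finset.range N, (G ^ i *ᵥ x) ⬝ᵥ (G ^ i *ᵥ x) := by
    intro x
    rw [hV, Matrix.sum_mulVec, dotProduct_sum]
    refine Finset.sum_congr rfl fun i _ => ?_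
    rw [← Matrix.mulVec_mulVec, Matrix.mulVec_transpose, dotProduct_comm,
      ← Matrix.dotProduct_mulVec]
  have hsymm : Vᵀ = V := by
    rw [hV, Matrix.transpose_sum]
    refine Finset.sum_congr rfl fun i _ => ?_
    rw [Matrix.transpose_mul, Matrix.transpose_transpose]
  have hnn : ∀ y : k → ℝ, 0 ≤ y ⬝ᵥ y := fun y =>
    Finset.sum_nonneg fun i _ => mul_self_nonneg _
  refine ⟨V, ⟨hsymm, fun x hx => ?_⟩, fun y hy => ?_⟩
  · rw [hq]
    refine Finset.sum_pos' (fun i _ => hnn _) ⟨0, Finset.mem_range.2 hN0, ?_⟩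
    rw [pow_zero, Matrix.one_mulVec]
    exact lt_of_le_of_ne (hnn x) (fun h => hx (dotProduct_self_eq_zero.1 h.symm))
  · have hx0 : (1 - A) *ᵥ y ≠ 0 := by
      intro h0
      apply hy
      rw [← Matrix.one_mulVec y, ← Matrix.nonsing_inv_mul _ hu, ← Matrix.mulVec_mulVec, h0,
        Matrix.mulVec_zero]
    have h1 := hN _ hx0
    have h2 : ((1 + A) *ᵥ y) ⬝ᵥ V *ᵥ ((1 + A) *ᵥ y) - ((1 - A) *ᵥ y) ⬝ᵥ V *ᵥ ((1 - A) *ᵥ y) < 0 := by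
      rw [← hG, ← Matrix.mulVec_mulVec, hq, hq, ← Finset.sum_sub_distrib]
      have := Finset.sum_range_sub (fun i => (G ^ i *ᵥ ((1 - A) *ᵥ y)) ⬝ᵥ (G ^ i *ᵥ ((1 - A) *ᵥ y))) N
      simp only [pow_succ, ← Matrix.mulVec_mulVec, pow_zero, Matrix.one_mulVec] at this
      simp only [Matrix.mulVec_mulVec] at this h1 ⊢
      rw [this]
      linarith
    rw [Matrix.add_mulVec, Matrix.sub_mulVec, Matrix.one_mulVec] at h2
    simp only [Matrix.mulVec_add, Matrix.mulVec_sub, dotProduct_add, dotProduct_sub,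
      add_dotProduct, sub_dotProduct] at h2
    rw [dot_symm hsymm (A *ᵥ y) y] at h2
    rw [← Matrix.mulVec_mulVec]
    linarith

lemma perturb_pos [Nonempty k] (M S : Matrix k k ℝ) (h : ∀ x : k → ℝ, x ≠ 0 → 0 < x ⬝ᵥ M *ᵥ x) :
    ∀ᶠ ε in nhds (0 : ℝ), ∀ x : k → ℝ, x ≠ 0 → 0 < x ⬝ᵥ (M + ε • S) *ᵥ x := by
  have hc : IsCompact (Metric.sphere (0 : k → ℝ) 1) := isCompact_sphere _ _
  have hcont : Continuous fun q : ℝ × (k → ℝ) => q.2 ⬝ᵥ (M + q.1 • S) *ᵥ q.2 := by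
    fun_prop
  have := hc.eventually_forall_of_forall_eventually (x₀ := (0 : ℝ))
    (P := fun ε x => 0 < x ⬝ᵥ (M + ε • S) *ᵥ x) (by
      intro x hx
      have hx0 : x ≠ 0 := by rintro rfl; simp at hx
      apply hcont.continuousAt.eventually (lt_mem_nhds _)
      simpa using h x hx0)
  filter_upwards [this] with ε hε x hx
  have hxn : 0 < ‖x‖ := norm_pos_iff.2 hx
  have h1 := hε (‖x‖⁻¹ • x) (by simp [norm_smul, hxn.ne'])
  rw [Matrix.mulVec_smul, smul_dotProduct, dotProduct_smul, smul_eq_mul, smul_eq_mul] at h1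
  exact pos_of_mul_pos_right (pos_of_mul_pos_right h1 (by positivity)) (by positivity)

lemma PDm.convex {E F : Matrix k k ℝ} (hE : PDm E) (hF : PDm F) {t : ℝ} (h0 : 0 ≤ t) (h1 : t ≤ 1) :
    PDm ((1 - t) • E + t • F) := by
  refine ⟨by simp [hE.1, hF.1], fun x hx => ?_⟩
  have e := hE.2 x hx
  have f := hF.2 x hx
  rw [Matrix.add_mulVec, Matrix.smul_mulVec, Matrix.smul_mulVec, dotProduct_add, dotProduct_smul,
    dotProduct_smul, smul_eq_mul, smul_eq_mul]
  rcases h0.eq_or_lt with h | h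
  · subst h; simpa using e
  · nlinarith [mul_pos h f, mul_nonneg (sub_nonneg.2 h1) e.le]

lemma NDm.convex {E F : Matrix k k ℝ} (hE : NDm E) (hF : NDm F) {t : ℝ} (h0 : 0 ≤ t) (h1 : t ≤ 1) :
    NDm ((1 - t) • E + t • F) := by
  intro x hx
  have e := hE x hx
  have f := hF x hx
  rw [Matrix.add_mulVec, Matrix.smul_mulVec, Matrix.smul_mulVec, dotProduct_add, dotProduct_smul,
    dotProduct_smul, smul_eq_mul, smul_eq_mul]
  rcases h0.eq_or_lt with h | h
  · subst h; simpa using e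
  · nlinarith [mul_pos h (neg_pos.2 f), mul_nonneg (sub_nonneg.2 h1) (neg_pos.2 e).le]

lemma dot_cong (P Q : Matrix k k ℝ) (x : k → ℝ) :
    x ⬝ᵥ (Pᵀ * Q * P) *ᵥ x = (P *ᵥ x) ⬝ᵥ Q *ᵥ (P *ᵥ x) := by
  rw [Matrix.mul_assoc, ← Matrix.mulVec_mulVec, Matrix.mulVec_transpose, dotProduct_comm,
    ← Matrix.dotProduct_mulVec, dotProduct_comm, ← Matrix.mulVec_mulVec, dotProduct_comm]

lemma mulVec_ne_zero_of_unit {P : Matrix k k ℝ} (hP : IsUnit P.det) {x : k → ℝ} (hx : x ≠ 0) :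
    P *ᵥ x ≠ 0 := by
  intro h0
  apply hx
  rw [← Matrix.one_mulVec x, ← Matrix.nonsing_inv_mul _ hP, ← Matrix.mulVec_mulVec, h0,
    Matrix.mulVec_zero]

lemma PDm.isUnit {E : Matrix k k ℝ} (hE : PDm E) : IsUnit E.det := by
  apply det_ne_zero_of_inj
  intro x hx
  by_contra h
  have := hE.2 x h
  rw [hx] at this
  simp at this

end aux2
section aux3

variable {n m p : ℕ}

lemma exists_unit_perturb (N : Matrix (Fin n) (Fin n) ℝ) :
    ∀ᶠ ε in nhdsWithin (0 : ℝ) {0}ᶜ, IsUnit (N + ε • (1 : Matrix (Fin n) (Fin n) ℝ)).det := by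
  have hfin : {ε : ℝ | -ε ∈ spectrum ℝ N}.Finite :=
    (Matrix.finite_spectrum N).preimage (neg_injective.injOn)
  have := nhdsNE_le_cofinite (0 : ℝ) hfin.compl_mem_cofinite
  filter_upwards [this] with ε hε
  have h1 : ¬ (-ε ∈ spectrum ℝ N) := hε
  rw [spectrum.mem_iff, not_not] at h1
  have h2 : N + ε • (1 : Matrix (Fin n) (Fin n) ℝ) = -(algebraMap ℝ _ (-ε) - N) := by
    rw [Algebra.algebraMap_eq_smul_one, neg_smul]; abel
  rw [← Matrix.isUnit_iff_isUnit_det, h2]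
  exact h1.neg

lemma lyap_block (hn : 1 ≤ n) (F : Matrix (Fin n ⊕ Fin n) (Fin n ⊕ Fin n) ℝ)
    (hF : IsStableMatrix F) :
    ∃ X N U : Matrix (Fin n) (Fin n) ℝ, PDm (fromBlocks X N Nᵀ U) ∧
      NDm (fromBlocks X N Nᵀ U * F) ∧ IsUnit N.det := by
  haveI : Nonempty (Fin n) := ⟨⟨0, hn⟩⟩
  obtain ⟨P, hP, hPF⟩ := lyapunov_exists F hF
  let S : Matrix (Fin n ⊕ Fin n) (Fin n ⊕ Fin n) ℝ := fromBlocks 0 1 1 0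
  have h1 := perturb_pos P S hP.2
  have h2 := perturb_pos (-(P * F)) (-(S * F)) (fun x hx => by
    have := hPF x hx
    rw [Matrix.neg_mulVec, dotProduct_neg]; linarith)
  have h3 := exists_unit_perturb P.toBlocks₁₂
  obtain ⟨ε, ⟨h1, h2⟩, h3⟩ := (((h1.and h2).filter_mono nhdsWithin_le_nhds).and h3).exists
  have hsymm : (P + ε • S)ᵀ = P + ε • S := by
    rw [Matrix.transpose_add, hP.1, Matrix.transpose_smul]
    simp [S, fromBlocks_transpose]
  have h12 : (P + ε • S).toBlocks₁₂ = P.toBlocks₁₂ + ε • (1 : Matrix (Fin n) (Fin n) ℝ) := by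
    ext i j; simp [S, toBlocks₁₂]
  have hb : fromBlocks (P + ε • S).toBlocks₁₁ (P + ε • S).toBlocks₁₂ ((P + ε • S).toBlocks₁₂)ᵀ
      (P + ε • S).toBlocks₂₂ = P + ε • S := by
    have : ((P + ε • S).toBlocks₁₂)ᵀ = (P + ε • S).toBlocks₂₁ := by
      conv_rhs => rw [← hsymm]
      rfl
    rw [this, fromBlocks_toBlocks]
  refine ⟨_, _, _, by rw [hb]; exact ⟨hsymm, h1⟩, ?_, by rw [h12]; exact h3⟩
  rw [hb]
  intro x hx
  have := h2 x hx
  have e : -(P * F) + ε • -(S * F) = -((P + ε • S) * F) := by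
    rw [Matrix.add_mul, Matrix.smul_mul, smul_neg]; abel
  rw [e, Matrix.neg_mulVec, dotProduct_neg] at this
  linarith

/-- The controller reconstructed from the linearising variables. -/
def Ksol (A : Matrix (Fin n) (Fin n) ℝ) (B : Matrix (Fin n) (Fin m) ℝ)
    (C : Matrix (Fin p) (Fin n) ℝ) (N X Y Ah : Matrix (Fin n) (Fin n) ℝ)
    (Bh : Matrix (Fin n) (Fin p) ℝ) (Ch : Matrix (Fin m) (Fin n) ℝ) :
    Matrix (Fin n) (Fin n) ℝ × Matrix (Fin n) (Fin p) ℝ × Matrix (Fin m) (Fin n) ℝ :=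
  (N⁻¹ * (Ah - X * A * Y - X * B * Ch - Bh * C * Y) * (N⁻¹ * (1 - X * Y))⁻¹, N⁻¹ * Bh,
    Ch * (N⁻¹ * (1 - X * Y))⁻¹)

lemma R_unit {N X Y : Matrix (Fin n) (Fin n) ℝ} (hN : IsUnit N.det)
    (hE : PDm (fromBlocks Y 1 1 X)) : IsUnit (N⁻¹ * (1 - X * Y)).det := by
  rw [Matrix.det_mul]
  refine IsUnit.mul ?_ ?_
  · exact Matrix.isUnit_nonsing_inv_det _ hN
  · apply det_ne_zero_of_inj
    intro v hv
    rw [Matrix.sub_mulVec, Matrix.one_mulVec, sub_eq_zero, ← Matrix.mulVec_mulVec] at hv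
    by_contra hv0
    have h1 := mulVec_ne_zero_of_unit hE.isUnit (x := Sum.elim (-v) (Y *ᵥ v)) (by
      intro h0
      apply hv0
      ext i
      simpa using congrFun h0 (Sum.inl i))
    apply h1
    rw [fromBlocks_mulVec]
    simp only [Sum.elim_comp_inl, Sum.elim_comp_inr, Matrix.one_mulVec, Matrix.mulVec_neg, ← hv]
    ext (i | i) <;> simp

lemma Ksol_stable (A : Matrix (Fin n) (Fin n) ℝ) (B : Matrix (Fin n) (Fin m) ℝ)
    (C : Matrix (Fin p) (Fin n) ℝ) (N X Y Ah : Matrix (Fin n) (Fin n) ℝ)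
    (Bh : Matrix (Fin n) (Fin p) ℝ) (Ch : Matrix (Fin m) (Fin n) ℝ)
    (hN : IsUnit N.det) (hE : PDm (fromBlocks Y 1 1 X))
    (hZ : NDm (fromBlocks (A * Y + B * Ch) A Ah (X * A + Bh * C))) :
    IsStableMatrix (Acl A B C (Ksol A B C N X Y Ah Bh Ch)) := by
  have hR := R_unit hN hE
  have hNR : N * (N⁻¹ * (1 - X * Y)) = 1 - X * Y := Matrix.mul_nonsing_inv_cancel_left _ _ hN
  unfold Ksol
  generalize hRd : N⁻¹ * (1 - X * Y) = R at *
  have hG : fromBlocks 1 0 X N * fromBlocks Y 1 R 0 = fromBlocks Y 1 1 X := by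
    rw [fromBlocks_multiply]
    simp [hNR]
  refine stable_of_pencil _ (fromBlocks Y 1 R 0) (fromBlocks 1 0 X N) _ _ hE hZ ?_ hG ?_
  · have := hE.isUnit
    rw [← hG, Matrix.det_mul] at this
    rw [Matrix.isUnit_iff_isUnit_det]
    exact isUnit_of_mul_isUnit_right this
  · unfold Acl
    have c1 : ∀ M : Matrix (Fin n) (Fin n) ℝ, M * R⁻¹ * R = M := fun M =>
      Matrix.nonsing_inv_mul_cancel_right _ _ hR
    have c2 : ∀ M : Matrix (Fin m) (Fin n) ℝ, M * R⁻¹ * R = M := fun M =>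
      Matrix.nonsing_inv_mul_cancel_right _ _ hR
    have c3 : ∀ M : Matrix (Fin n) (Fin n) ℝ, N * (N⁻¹ * M) = M := fun M =>
      Matrix.mul_nonsing_inv_cancel_left _ _ hN
    simp only [fromBlocks_multiply, Matrix.one_mul, Matrix.zero_mul, Matrix.mul_one,
      Matrix.mul_zero, add_zero, Matrix.add_mul]
    rw [fromBlocks_inj]
    refine ⟨?_, rfl, ?_, ?_⟩
    · rw [Matrix.mul_assoc B, c2]
    · rw [Matrix.mul_assoc N (_ * _ * R⁻¹) R, c1, c3]
      rw [Matrix.mul_assoc X (B * _) R, Matrix.mul_assoc B _ R, c2, Matrix.mul_assoc N⁻¹ Bh C, c3,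
        Matrix.mul_assoc X B Ch]
      abel
    · rw [Matrix.mul_assoc N⁻¹ Bh C, c3]

lemma Ksol_inv (A : Matrix (Fin n) (Fin n) ℝ) (B : Matrix (Fin n) (Fin m) ℝ)
    (C : Matrix (Fin p) (Fin n) ℝ) (N X Y R : Matrix (Fin n) (Fin n) ℝ)
    (K : Matrix (Fin n) (Fin n) ℝ × Matrix (Fin n) (Fin p) ℝ × Matrix (Fin m) (Fin n) ℝ)
    (hN : IsUnit N.det) (hR : IsUnit R.det) (hXY : X * Y + N * R = 1) :
    Ksol A B C N X Y (X * A * Y + X * B * (K.2.2 * R) + N * K.2.1 * C * Y + N * K.1 * R)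
      (N * K.2.1) (K.2.2 * R) = K := by
  have hRd : N⁻¹ * (1 - X * Y) = R := by
    rw [← hXY, add_sub_cancel_left, Matrix.nonsing_inv_mul_cancel_left _ _ hN]
  unfold Ksol
  rw [hRd]
  refine Prod.ext ?_ (Prod.ext ?_ ?_)
  · simp only
    have : X * A * Y + X * B * (K.2.2 * R) + N * K.2.1 * C * Y + N * K.1 * R - X * A * Y
        - X * B * (K.2.2 * R) - N * K.2.1 * C * Y = N * (K.1 * R) := by
      rw [Matrix.mul_assoc N K.1 R]; abel
    rw [this, Matrix.nonsing_inv_mul_cancel_left _ _ hN, Matrix.mul_nonsing_inv_cancel_right _ _ hR]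
  · exact Matrix.nonsing_inv_mul_cancel_left _ _ hN
  · exact Matrix.mul_nonsing_inv_cancel_right _ _ hR

lemma forward (hn : 1 ≤ n) (A : Matrix (Fin n) (Fin n) ℝ) (B : Matrix (Fin n) (Fin m) ℝ)
    (C : Matrix (Fin p) (Fin n) ℝ)
    (K : Matrix (Fin n) (Fin n) ℝ × Matrix (Fin n) (Fin p) ℝ × Matrix (Fin m) (Fin n) ℝ)
    (hK : IsStableMatrix (Acl A B C K)) :
    ∃ (N X Y Ah : Matrix (Fin n) (Fin n) ℝ)
      (Bh : Matrix (Fin n) (Fin p) ℝ) (Ch : Matrix (Fin m) (Fin n) ℝ),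
      IsUnit N.det ∧ PDm (fromBlocks Y 1 1 X) ∧
      NDm (fromBlocks (A * Y + B * Ch) A Ah (X * A + Bh * C)) ∧
      Ksol A B C N X Y Ah Bh Ch = K := by
  obtain ⟨X, N, U, hP, hPF, hN⟩ := lyap_block hn _ hK
  have hPu := hP.isUnit
  set P := fromBlocks X N Nᵀ U with hPdef
  have hXs : Xᵀ = X := by
    have := hP.1
    rw [hPdef, fromBlocks_transpose, fromBlocks_inj] at this
    exact this.1
  set Q := P⁻¹ with hQ
  have hQs : Qᵀ = Q := by rw [hQ, Matrix.transpose_nonsing_inv, hP.1]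
  set Y := Q.toBlocks₁₁ with hY
  set R := Q.toBlocks₂₁ with hR
  have hYs : Yᵀ = Y := by
    conv_rhs => rw [hY, ← hQs]
    rfl
  have hPQ : P * Q = 1 := Matrix.mul_nonsing_inv _ hPu
  rw [← fromBlocks_toBlocks Q, hPdef, fromBlocks_multiply, ← fromBlocks_one, fromBlocks_inj] at hPQ
  obtain ⟨q1, -, q3, -⟩ := hPQ
  rw [← hY, ← hR] at q1 q3
  have hNt : IsUnit (Nᵀ).det := by rwa [Matrix.det_transpose]
  have hRu : IsUnit R.det := by
    apply det_ne_zero_of_inj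
    intro v hv
    have e3 := congrArg (fun M => M *ᵥ v) q3
    have e1 := congrArg (fun M => M *ᵥ v) q1
    simp only [Matrix.add_mulVec, ← Matrix.mulVec_mulVec, hv, Matrix.mulVec_zero, add_zero,
      Matrix.zero_mulVec, Matrix.one_mulVec] at e1 e3
    have : Y *ᵥ v = 0 := by
      by_contra h
      exact mulVec_ne_zero_of_unit hNt h e3
    rw [← e1, this, Matrix.mulVec_zero]
  set Pi : Matrix (Fin n ⊕ Fin n) (Fin n ⊕ Fin n) ℝ := fromBlocks Y 1 R 0 with hPi
  have hPPi : P * Pi = fromBlocks 1 X 0 Nᵀ := by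
    rw [hPdef, hPi, fromBlocks_multiply, q1, q3]
    simp
  have hPiP : Piᵀ * P = fromBlocks 1 0 X N := by
    rw [← hP.1, ← Matrix.transpose_mul, hPPi, fromBlocks_transpose]
    simp [hXs]
  have hPiu : IsUnit Pi.det := by
    have : IsUnit (P * Pi).det := by
      rw [hPPi, Matrix.det_fromBlocks_zero₂₁, Matrix.det_one, one_mul]
      exact hNt
    rw [Matrix.det_mul] at this
    exact isUnit_of_mul_isUnit_right this
  have hE : Piᵀ * P * Pi = fromBlocks Y 1 1 X := by
    rw [hPiP, hPi, fromBlocks_multiply, q1]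
    simp
  refine ⟨N, X, Y, _, _, _, hN, ?_, ?_, Ksol_inv A B C N X Y R K hN hRu q1⟩
  · rw [← hE]
    refine ⟨?_, fun x hx => ?_⟩
    · rw [Matrix.transpose_mul, Matrix.transpose_mul, Matrix.transpose_transpose, hP.1,
        Matrix.mul_assoc]
    · rw [dot_cong]
      exact hP.2 _ (mulVec_ne_zero_of_unit hPiu hx)
  · have hZ : Piᵀ * (P * Acl A B C K) * Pi = fromBlocks (A * Y + B * (K.2.2 * R)) A
        (X * A * Y + X * B * (K.2.2 * R) + N * K.2.1 * C * Y + N * K.1 * R)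
        (X * A + N * K.2.1 * C) := by
      rw [← Matrix.mul_assoc, hPiP, hPi]
      unfold Acl
      simp only [fromBlocks_multiply, Matrix.one_mul, Matrix.zero_mul, Matrix.mul_one,
        Matrix.mul_zero, add_zero, Matrix.add_mul, Matrix.mul_assoc]
      congr 1
      abel
    rw [← hZ]
    intro x hx
    rw [dot_cong]
    exact hPF _ (mulVec_ne_zero_of_unit hPiu hx)

lemma endpoint (A V : Matrix (Fin n) (Fin n) ℝ) (hV : PDm V) (hVA : NDm (V * A)) :
    PDm (fromBlocks V⁻¹ 1 1 ((2 : ℝ) • V)) ∧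
    NDm (fromBlocks (A * V⁻¹) A (-Aᵀ) ((2 : ℝ) • V * A)) := by
  have hu := hV.isUnit
  have key : ∀ x : Fin n ⊕ Fin n → ℝ, x ≠ 0 → ∃ z y : Fin n → ℝ, x = Sum.elim (V *ᵥ z) y ∧
      (z ≠ 0 ∨ y ≠ 0) := by
    intro x hx
    refine ⟨V⁻¹ *ᵥ (x ∘ Sum.inl), x ∘ Sum.inr, ?_, ?_⟩
    · rw [Matrix.mulVec_mulVec, Matrix.mul_nonsing_inv _ hu, Matrix.one_mulVec,
        Sum.elim_comp_inl_inr]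
    · by_contra hc
      push Not at hc
      apply hx
      have h1 : x ∘ Sum.inl = 0 := by
        rw [← Matrix.one_mulVec (x ∘ Sum.inl), ← Matrix.mul_nonsing_inv _ hu,
          ← Matrix.mulVec_mulVec, hc.1, Matrix.mulVec_zero]
      rw [← Sum.elim_comp_inl_inr x, h1, hc.2]
      ext (i | i) <;> simp
  have Vnn : ∀ x, 0 ≤ x ⬝ᵥ V *ᵥ x := fun x => by
    by_cases hx : x = 0
    · simp [hx]
    · exact (hV.2 x hx).le
  have Znn : ∀ x, x ⬝ᵥ (V * A) *ᵥ x ≤ 0 := fun x => by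
    by_cases hx : x = 0
    · simp [hx]
    · exact (hVA x hx).le
  have hVz : ∀ z, V⁻¹ *ᵥ (V *ᵥ z) = z := fun z => by
    rw [Matrix.mulVec_mulVec, Matrix.nonsing_inv_mul _ hu, Matrix.one_mulVec]
  refine ⟨⟨?_, ?_⟩, ?_⟩
  · rw [fromBlocks_transpose, Matrix.transpose_nonsing_inv, hV.1]
    simp [hV.1]
  · intro x hx
    obtain ⟨z, y, rfl, hzy⟩ := key x hx
    rw [fromBlocks_mulVec, sumElim_dotProduct_sumElim]
    simp only [Sum.elim_comp_inl, Sum.elim_comp_inr, hVz, Matrix.one_mulVec, dotProduct_add,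
      Matrix.smul_mulVec, dotProduct_smul, smul_eq_mul]
    have e1 : (V *ᵥ z) ⬝ᵥ z = z ⬝ᵥ V *ᵥ z := dotProduct_comm _ _
    have e2 : (V *ᵥ z) ⬝ᵥ y = y ⬝ᵥ V *ᵥ z := dotProduct_comm _ _
    have e3 : (z + y) ⬝ᵥ V *ᵥ (z + y) = z ⬝ᵥ V *ᵥ z + 2 * (y ⬝ᵥ V *ᵥ z) + y ⬝ᵥ V *ᵥ y := by
      rw [Matrix.mulVec_add, dotProduct_add, add_dotProduct, add_dotProduct, dot_symm hV.1 z y]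
      ring
    rw [e1, e2]
    by_cases hy : y = 0
    · subst hy
      have := hV.2 z (by simpa using hzy)
      simpa using this
    · linarith [Vnn (z + y), hV.2 y hy]
  · intro x hx
    obtain ⟨z, y, rfl, hzy⟩ := key x hx
    rw [fromBlocks_mulVec, sumElim_dotProduct_sumElim]
    simp only [Sum.elim_comp_inl, Sum.elim_comp_inr, ← Matrix.mulVec_mulVec, hVz, dotProduct_add,
      Matrix.smul_mulVec, dotProduct_smul, smul_eq_mul, Matrix.neg_mulVec, dotProduct_neg,
      Matrix.smul_mul]
    have e1 : (V *ᵥ z) ⬝ᵥ A *ᵥ z = z ⬝ᵥ (V * A) *ᵥ z := by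
      rw [← Matrix.mulVec_mulVec, dotProduct_comm, dot_symm hV.1]
    have e2 : y ⬝ᵥ Aᵀ *ᵥ (V *ᵥ z) = (V *ᵥ z) ⬝ᵥ A *ᵥ y := by
      rw [Matrix.mulVec_transpose, dotProduct_comm, ← Matrix.dotProduct_mulVec]
    have e3 : y ⬝ᵥ V *ᵥ (A *ᵥ y) = y ⬝ᵥ (V * A) *ᵥ y := by rw [Matrix.mulVec_mulVec]
    rw [e1, e2, e3]
    rcases hzy with h | h
    · linarith [hVA z h, Znn y]
    · linarith [hVA y h, Znn z]

lemma stable_blockdiag (A D : Matrix (Fin n) (Fin n) ℝ) :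
    IsStableMatrix (fromBlocks A 0 0 D) ↔ IsStableMatrix A ∧ IsStableMatrix D := by
  simp only [stable_iff_real]
  constructor
  · intro h
    constructor
    · intro α β a b hab ha hb
      refine h α β (Sum.elim a 0) (Sum.elim b 0) ?_ ?_ ?_
      · rcases hab with h | h
        · left; intro h0; apply h; ext i; simpa using congrFun h0 (Sum.inl i)
        · right; intro h0; apply h; ext i; simpa using congrFun h0 (Sum.inl i)
      · rw [fromBlocks_mulVec]; ext (i | i) <;> simp [ha]
      · rw [fromBlocks_mulVec]; ext (i | i) <;> simp [hb]
    · intro α β a b hab ha hb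
      refine h α β (Sum.elim 0 a) (Sum.elim 0 b) ?_ ?_ ?_
      · rcases hab with h | h
        · left; intro h0; apply h; ext i; simpa using congrFun h0 (Sum.inr i)
        · right; intro h0; apply h; ext i; simpa using congrFun h0 (Sum.inr i)
      · rw [fromBlocks_mulVec]; ext (i | i) <;> simp [ha]
      · rw [fromBlocks_mulVec]; ext (i | i) <;> simp [hb]
  · rintro ⟨h1, h2⟩ α β a b hab ha hb
    rw [fromBlocks_mulVec] at ha hb
    by_cases h : a ∘ Sum.inl ≠ 0 ∨ b ∘ Sum.inl ≠ 0
    · refine h1 α β (a ∘ Sum.inl) (b ∘ Sum.inl) h ?_ ?_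
      · ext i; simpa using congrFun ha (Sum.inl i)
      · ext i; simpa using congrFun hb (Sum.inl i)
    · push Not at h
      refine h2 α β (a ∘ Sum.inr) (b ∘ Sum.inr) ?_ ?_ ?_
      · by_contra hc
        push Not at hc
        have ha0 : a = 0 := by
          rw [← Sum.elim_comp_inl_inr a, h.1, hc.1]; ext (i | i) <;> simp
        have hb0 : b = 0 := by
          rw [← Sum.elim_comp_inl_inr b, h.2, hc.2]; ext (i | i) <;> simp
        simp [ha0, hb0] at hab
      · ext i; simpa using congrFun ha (Sum.inr i)
      · ext i; simpa using congrFun hb (Sum.inr i)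

lemma stable_star (D : Matrix (Fin n) (Fin n) ℝ) (hD : IsStableMatrix D) {t : ℝ} (h0 : 0 ≤ t)
    (h1 : t ≤ 1) : IsStableMatrix ((1 - t) • D - t • (1 : Matrix (Fin n) (Fin n) ℝ)) := by
  rw [stable_iff_real] at hD ⊢
  intro α β a b hab ha hb
  rw [Matrix.sub_mulVec, Matrix.smul_mulVec, Matrix.smul_mulVec, Matrix.one_mulVec] at ha hb
  rcases h1.eq_or_lt with h | h
  · subst h
    have ha' : ∀ i, (α + 1) * a i = β * b i := fun i => by
      have := congrFun ha i
      simp at this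
      linarith
    have hb' : ∀ i, (α + 1) * b i = - β * a i := fun i => by
      have := congrFun hb i
      simp at this
      linarith
    by_contra hα
    push Not at hα
    have hs : ∀ i, a i = 0 ∧ b i = 0 := fun i => by
      have : (α + 1) * (a i ^ 2 + b i ^ 2) = 0 := by
        linear_combination a i * ha' i + b i * hb' i
      have h3 : a i ^ 2 + b i ^ 2 = 0 := by
        rcases mul_eq_zero.1 this with h | h
        · linarith
        · exact h
      constructor <;> nlinarith [sq_nonneg (a i), sq_nonneg (b i)]
    rcases hab with h | h
    · exact h (funext fun i => (hs i).1)
    · exact h (funext fun i => (hs i).2)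
  · have hs : (1 - t) ≠ 0 := by linarith
    have := hD ((α + t) / (1 - t)) (β / (1 - t)) a b hab
      (by
        ext i
        have := congrFun ha i
        simp only [Pi.add_apply, Pi.sub_apply, Pi.smul_apply, smul_eq_mul] at this ⊢
        field_simp
        linarith)
      (by
        ext i
        have := congrFun hb i
        simp only [Pi.add_apply, Pi.sub_apply, Pi.smul_apply, smul_eq_mul] at this ⊢
        field_simp
        linarith)
    rw [div_lt_iff₀ (by linarith)] at this
    linarith

lemma continuousOn_matrix_inv {f : ℝ → Matrix (Fin n) (Fin n) ℝ} {s : Set ℝ} (hf : Continuous f)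
    (hs : ∀ t ∈ s, IsUnit (f t).det) : ContinuousOn (fun t => (f t)⁻¹) s := by
  simp only [Matrix.inv_def, Ring.inverse_eq_inv']
  have h1 : ContinuousOn (fun t => ((f t).det)⁻¹) s :=
    hf.matrix_det.continuousOn.inv₀ (fun t ht => (hs t ht).ne_zero)
  exact h1.smul hf.matrix_adjugate.continuousOn

end aux3
/-- If `(A, B)` is controllable, `(C, A)` is observable and the plant is
open-loop stable (`A` is a stable matrix), then the set `𝒞_n` of full-order stabilizing
controllers is path-connected. -/
theorem Cn_pathConnected_of_openLoop_stable (n m p : ℕ)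
    (hn : 1 ≤ n) (hm : 0 < m) (hp : 0 < p)
    (A : Matrix (Fin n) (Fin n) ℝ) (B : Matrix (Fin n) (Fin m) ℝ)
    (C : Matrix (Fin p) (Fin n) ℝ)
    (hctrb : Controllable A B) (hobs : Controllable Aᵀ Cᵀ)
    (hA : IsStableMatrix A) :
    IsPathConnected {K : Matrix (Fin n) (Fin n) ℝ × Matrix (Fin n) (Fin p) ℝ ×
        Matrix (Fin m) (Fin n) ℝ | IsStableMatrix (Acl A B C K)} := by

  haveI : Nonempty (Fin n) := ⟨⟨0, hn⟩⟩
  set F := {K : Matrix (Fin n) (Fin n) ℝ × Matrix (Fin n) (Fin p) ℝ ×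
        Matrix (Fin m) (Fin n) ℝ | IsStableMatrix (Acl A B C K)} with hF
  have hdiag : ∀ D : Matrix (Fin n) (Fin n) ℝ, (D, (0 : Matrix (Fin n) (Fin p) ℝ),
      (0 : Matrix (Fin m) (Fin n) ℝ)) ∈ F ↔ IsStableMatrix D := by
    intro D
    rw [hF, Set.mem_setOf_eq, Acl]
    simp only [Matrix.mul_zero, Matrix.zero_mul]
    rw [stable_blockdiag]
    exact and_iff_right hA
  obtain ⟨V, hV, hVA⟩ := lyapunov_exists A hA
  obtain ⟨hE1, hZ1⟩ := endpoint A V hV hVA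
  have hmid : ∀ D : Matrix (Fin n) (Fin n) ℝ, IsStableMatrix D →
      JoinedIn F (D, 0, 0) (-1, 0, 0) := by
    intro D hD
    refine JoinedIn.ofLine (f := fun t : ℝ => ((1 - t) • D - t • (1 : Matrix (Fin n) (Fin n) ℝ),
      0, 0)) ?_ (by simp) (by simp) ?_
    · exact Continuous.continuousOn (by fun_prop)
    · rintro _ ⟨t, ht, rfl⟩
      exact (hdiag _).2 (stable_star D hD ht.1 ht.2)
  refine ⟨(-1, 0, 0), (hdiag _).2 ?_, fun K hK => ?_⟩
  · have := stable_star A hA zero_le_one le_rfl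
    simpa using this
  apply JoinedIn.symm
  obtain ⟨N, X, Y, Ah, Bh, Ch, hN, hE0, hZ0, hKs⟩ := forward hn A B C K hK
  let Xt : ℝ → Matrix (Fin n) (Fin n) ℝ := fun t => (1 - t) • X + t • ((2 : ℝ) • V)
  let Yt : ℝ → Matrix (Fin n) (Fin n) ℝ := fun t => (1 - t) • Y + t • V⁻¹
  let At : ℝ → Matrix (Fin n) (Fin n) ℝ := fun t => (1 - t) • Ah + t • (-Aᵀ)
  let f := fun t : ℝ => Ksol A B C N (Xt t) (Yt t) (At t) ((1 - t) • Bh) ((1 - t) • Ch)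
  have hEt : ∀ t ∈ Set.Icc (0 : ℝ) 1, PDm (fromBlocks (Yt t) 1 1 (Xt t)) := by
    intro t ht
    have := hE0.convex hE1 ht.1 ht.2
    rw [fromBlocks_smul, fromBlocks_smul, fromBlocks_add, ← add_smul, sub_add_cancel,
      one_smul] at this
    exact this
  have hZt : ∀ t ∈ Set.Icc (0 : ℝ) 1, NDm (fromBlocks (A * Yt t + B * ((1 - t) • Ch)) A (At t)
      (Xt t * A + ((1 - t) • Bh) * C)) := by
    intro t ht
    have := hZ0.convex hZ1 ht.1 ht.2
    rw [fromBlocks_smul, fromBlocks_smul, fromBlocks_add, ← add_smul, sub_add_cancel,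
      one_smul] at this
    convert this using 2
    · simp only [Yt, Matrix.mul_add, Matrix.mul_smul, smul_add]; abel
    · simp only [Xt, Matrix.add_mul, Matrix.smul_mul, smul_add]; abel
  have hft : ∀ t ∈ Set.Icc (0 : ℝ) 1, f t ∈ F := fun t ht =>
    Ksol_stable A B C N _ _ _ _ _ hN (hEt t ht) (hZt t ht)
  have hXc : Continuous Xt := by fun_prop
  have hYc : Continuous Yt := by fun_prop
  have hAc : Continuous At := by fun_prop
  have hRc : ContinuousOn (fun t => (N⁻¹ * (1 - Xt t * Yt t))⁻¹) (Set.Icc (0 : ℝ) 1) :=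
    continuousOn_matrix_inv (by fun_prop) (fun t ht => R_unit hN (hEt t ht))
  have hmul : ∀ {q r s : ℕ} {u : ℝ → Matrix (Fin q) (Fin r) ℝ} {v : ℝ → Matrix (Fin r) (Fin s) ℝ},
      ContinuousOn u (Set.Icc (0 : ℝ) 1) → ContinuousOn v (Set.Icc (0 : ℝ) 1) →
      ContinuousOn (fun t => u t * v t) (Set.Icc (0 : ℝ) 1) := by
    intro q r s u v hu hv
    rw [continuousOn_iff_continuous_restrict] at hu hv ⊢
    exact hu.matrix_mul hv
  have hfc : ContinuousOn f (Set.Icc (0 : ℝ) 1) := by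
    refine ContinuousOn.prodMk ?_ (ContinuousOn.prodMk ?_ ?_)
    · exact hmul (Continuous.continuousOn (by fun_prop)) hRc
    · exact Continuous.continuousOn (by fun_prop)
    · exact hmul (Continuous.continuousOn (by fun_prop)) hRc
  have hf0 : f 0 = K := by
    rw [← hKs]; simp [f, Xt, Yt, At]
  have hf1 : f 1 = ((f 1).1, 0, 0) := by
    simp [f, Ksol]
  have hD : IsStableMatrix (f 1).1 := by
    rw [← hdiag, ← hf1]
    exact hft 1 (by simp)
  have hj : JoinedIn F K (f 1) := JoinedIn.ofLine hfc hf0 rfl (by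
    rintro _ ⟨t, ht, rfl⟩
    exact hft t ht)
  rw [hf1] at hj
  exact hj.trans (hmid _ hD)
end
end
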